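/- Let p, q : ℝ → ℝ³ be differentiable trajectories with ‖p(t)‖ = ‖q(t)‖ = 1 and p(t) ≠ ±q(t) for all t. For each t, let Rᵀ(t) be the inverse of the rotation along the geodesic connecting p(t) to q(t), explicitly Rᵀ(t)(x) := c·x − s·(k × x) + (1 − c)·(k·x)·k with c := p(t)·q(t), s := ‖p(t) × q(t)‖, k := (p(t) × q(t))/‖p(t) × q(t)‖. Then for every t, d/dt [arccos(p(t)·q(t))] = −(p′(t) − Rᵀ(t)(q′(t))) · Y(p(t), q(t)). -/

import Mathlib

open Real

/-- Euclidean dot product on ℝ³. -/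
def dot3 (a b : Fin 3 → ℝ) : ℝ := a 0 * b 0 + a 1 * b 1 + a 2 * b 2

/-- Euclidean norm on ℝ³. -/
noncomputable def norm3 (a : Fin 3 → ℝ) : ℝ := Real.sqrt (dot3 a a)

/-- Cross product on ℝ³. -/
def cross3 (a b : Fin 3 → ℝ) : Fin 3 → ℝ :=
  ![a 1 * b 2 - a 2 * b 1, a 2 * b 0 - a 0 * b 2, a 0 * b 1 - a 1 * b 0]

/-- The geodesic vector pointing from the unit vector `x` towards the unit vector `y`:
`Y(x,y) = (y − (y·x)x)/‖y − (y·x)x‖`. -/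
noncomputable def Yvec (x y : Fin 3 → ℝ) : Fin 3 → ℝ :=
  (norm3 (y - dot3 y x • x))⁻¹ • (y - dot3 y x • x)

/-- The inverse (transpose) of the rotation along the geodesic connecting the unit vectors
`p` and `q`, applied to `x`: `Rᵀ(x) = c·x − s·(k × x) + (1 − c)·(k·x)·k` with `c = p·q`,
`s = ‖p × q‖`, `k = (p × q)/‖p × q‖`. -/
noncomputable def RgeoT (p q x : Fin 3 → ℝ) : Fin 3 → ℝ :=
  dot3 p q • x
    - norm3 (cross3 p q) • cross3 ((norm3 (cross3 p q))⁻¹ • cross3 p q) x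
    + ((1 - dot3 p q) * dot3 ((norm3 (cross3 p q))⁻¹ • cross3 p q) x)
        • ((norm3 (cross3 p q))⁻¹ • cross3 p q)

theorem dot3_self_of_norm3_eq_one {a : Fin 3 → ℝ} (h : norm3 a = 1) : dot3 a a = 1 :=
  Real.sqrt_eq_one.mp h

theorem eq_zero_of_dot3_self {a : Fin 3 → ℝ} (h : dot3 a a = 0) : a = 0 := by
  unfold dot3 at h
  ext i
  fin_cases i <;> simp <;> nlinarith [mul_self_nonneg (a 0), mul_self_nonneg (a 1),
    mul_self_nonneg (a 2)]

theorem dot3_comm (a b : Fin 3 → ℝ) : dot3 a b = dot3 b a := by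
  unfold dot3
  ring

theorem dot3_ne_one {a b : Fin 3 → ℝ} (ha : dot3 a a = 1) (hb : dot3 b b = 1) (h : a ≠ b) :
    dot3 a b ≠ 1 := by
  intro hab
  refine h (sub_eq_zero.mp (eq_zero_of_dot3_self ?_))
  simp only [dot3, Pi.sub_apply] at *
  linear_combination ha + hb - 2 * hab

theorem dot3_ne_neg_one {a b : Fin 3 → ℝ} (ha : dot3 a a = 1) (hb : dot3 b b = 1)
    (h : a ≠ -b) : dot3 a b ≠ -1 := by
  intro hab
  refine h (eq_neg_of_add_eq_zero_left (eq_zero_of_dot3_self ?_))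
  simp only [dot3, Pi.add_apply] at *
  linear_combination ha + hb + 2 * hab

/-- Lagrange's identity. -/
theorem dot3_cross3_self (a b : Fin 3 → ℝ) :
    dot3 (cross3 a b) (cross3 a b) = dot3 a a * dot3 b b - dot3 a b ^ 2 := by
  simp [dot3, cross3]
  ring

theorem norm3_cross3 {a b : Fin 3 → ℝ} (ha : dot3 a a = 1) (hb : dot3 b b = 1) :
    norm3 (cross3 a b) = √(1 - dot3 a b ^ 2) := by
  rw [norm3, dot3_cross3_self, ha, hb, one_mul]

theorem norm3_sub_dot3_smul {a b : Fin 3 → ℝ} (ha : dot3 a a = 1) (hb : dot3 b b = 1) :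
    norm3 (b - dot3 b a • a) = √(1 - dot3 a b ^ 2) := by
  have h : dot3 (b - dot3 b a • a) (b - dot3 b a • a)
      = dot3 b b - 2 * dot3 a b ^ 2 + dot3 a b ^ 2 * dot3 a a := by
    simp only [dot3, Pi.sub_apply, Pi.smul_apply, smul_eq_mul]
    ring
  rw [norm3, h, ha, hb]
  ring_nf

theorem one_sub_dot3_sq_pos {a b : Fin 3 → ℝ} (ha : dot3 a a = 1) (hb : dot3 b b = 1)
    (h : a ≠ b) (h' : a ≠ -b) : 0 < 1 - dot3 a b ^ 2 := by
  refine lt_of_le_of_ne ?_ fun h0 => ?_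
  · have hL := dot3_cross3_self a b
    rw [ha, hb, one_mul] at hL
    rw [← hL]
    simp only [dot3, ← sq]
    positivity
  · rcases sq_eq_sq_iff_eq_or_eq_neg.mp (show dot3 a b ^ 2 = 1 ^ 2 by linarith) with h1 | h1
    · exact dot3_ne_one ha hb h h1
    · exact dot3_ne_neg_one ha hb h' h1

theorem dot3_Yvec {p q : Fin 3 → ℝ} (hp : dot3 p p = 1) (hq : dot3 q q = 1)
    (x : Fin 3 → ℝ) :
    dot3 x (Yvec p q) = (√(1 - dot3 p q ^ 2))⁻¹ * (dot3 x q - dot3 p q * dot3 x p) := by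
  rw [Yvec, norm3_sub_dot3_smul hp hq]
  simp only [dot3, Pi.sub_apply, Pi.smul_apply, smul_eq_mul]
  ring

/-- The vector `Rᵀ x` in terms of `p`, `q` and `p × q`, by the triple product expansion. -/
theorem RgeoT_eq {p q : Fin 3 → ℝ} (hs : norm3 (cross3 p q) ≠ 0) (x : Fin 3 → ℝ) :
    RgeoT p q x = dot3 p q • x - (dot3 p x • q - dot3 q x • p)
      + ((1 - dot3 p q) * dot3 (cross3 p q) x * (norm3 (cross3 p q))⁻¹ ^ 2) • cross3 p q := by
  have hc : norm3 (cross3 p q) • cross3 ((norm3 (cross3 p q))⁻¹ • cross3 p q) x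
      = dot3 p x • q - dot3 q x • p := by
    have h1 : norm3 (cross3 p q) • cross3 ((norm3 (cross3 p q))⁻¹ • cross3 p q) x
        = (norm3 (cross3 p q) * (norm3 (cross3 p q))⁻¹) • cross3 (cross3 p q) x := by
      generalize (norm3 (cross3 p q))⁻¹ = r
      generalize norm3 (cross3 p q) = s
      ext i
      fin_cases i <;> simp [cross3] <;> ring
    rw [h1, mul_inv_cancel₀ hs, one_smul]
    ext i
    fin_cases i <;> simp [cross3, dot3] <;> ring
  rw [RgeoT, hc]
  generalize (norm3 (cross3 p q))⁻¹ = r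
  congr 1
  ext i
  simp only [dot3, Pi.smul_apply, smul_eq_mul]
  ring

/-- `Rᵀ` moves a tangent vector at `q` to one at `p`; this is its component towards `q`. -/
theorem dot3_RgeoT_Yvec {p q x : Fin 3 → ℝ} (hp : dot3 p p = 1) (hq : dot3 q q = 1)
    (hpos : 0 < 1 - dot3 p q ^ 2) (hx : dot3 q x = 0) :
    dot3 (RgeoT p q x) (Yvec p q) = -((√(1 - dot3 p q ^ 2))⁻¹ * dot3 p x) := by
  have hs : norm3 (cross3 p q) ≠ 0 := by
    rw [norm3_cross3 hp hq]
    exact (Real.sqrt_pos.mpr hpos).ne'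
  rw [dot3_Yvec hp hq, RgeoT_eq hs, hx, zero_smul, sub_zero]
  generalize (1 - dot3 p q) * dot3 (cross3 p q) x * (norm3 (cross3 p q))⁻¹ ^ 2 = m
  have h1 : dot3 (dot3 p q • x - dot3 p x • q + m • cross3 p q) q
      = dot3 p q * dot3 q x - dot3 p x * dot3 q q := by
    simp [dot3, cross3]
    ring
  have h2 : dot3 (dot3 p q • x - dot3 p x • q + m • cross3 p q) p = 0 := by
    simp [dot3, cross3]
    ring
  rw [h1, h2, hx, hq]
  ring

theorem HasDerivAt.dot3 {p q : ℝ → Fin 3 → ℝ} {p' q' : Fin 3 → ℝ} {t : ℝ}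
    (hp : HasDerivAt p p' t) (hq : HasDerivAt q q' t) :
    HasDerivAt (fun s => dot3 (p s) (q s)) (dot3 p' (q t) + dot3 (p t) q') t := by
  have hp := hasDerivAt_pi.mp hp
  have hq := hasDerivAt_pi.mp hq
  refine ((((hp 0).mul (hq 0)).add ((hp 1).mul (hq 1))).add
    ((hp 2).mul (hq 2))).congr_deriv ?_
  simp only [_root_.dot3]
  ring

/-- The velocity of a trajectory on the unit sphere is tangent to the sphere. -/
theorem dot3_deriv_eq_zero {q : ℝ → Fin 3 → ℝ} {q' : Fin 3 → ℝ} {t : ℝ}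
    (hq : HasDerivAt q q' t) (hu : ∀ s, dot3 (q s) (q s) = 1) : dot3 (q t) q' = 0 := by
  have h := hq.dot3 hq
  simp only [hu] at h
  have h0 := h.unique (hasDerivAt_const t (1 : ℝ))
  simp only [dot3] at *
  linear_combination h0 / 2

/-- For two differentiable trajectories `p`, `q` on the unit sphere with `p(t) ≠ ±q(t)`,
`d/dt arccos(p(t)·q(t)) = −(p′(t) − Rᵀ(t)(q′(t))) · Y(p(t), q(t))`, where `Rᵀ(t)` is the
inverse of the rotation along the geodesic connecting `p(t)` to `q(t)`. -/
theorem geodesic_distance_deriv_rotated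
    (p q : ℝ → Fin 3 → ℝ) (hp : Differentiable ℝ p) (hq : Differentiable ℝ q)
    (hpu : ∀ t, norm3 (p t) = 1) (hqu : ∀ t, norm3 (q t) = 1)
    (hne : ∀ t, p t ≠ q t) (hne' : ∀ t, p t ≠ -(q t)) :
    ∀ t, deriv (fun s => Real.arccos (dot3 (p s) (q s))) t
      = -(dot3 (deriv p t - RgeoT (p t) (q t) (deriv q t)) (Yvec (p t) (q t))) := by
  intro t
  have hp1 := fun s => dot3_self_of_norm3_eq_one (hpu s)
  have hq1 := fun s => dot3_self_of_norm3_eq_one (hqu s)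
  have hpos := one_sub_dot3_sq_pos (hp1 t) (hq1 t) (hne t) (hne' t)
  have hdp := (hp t).hasDerivAt
  have hdq := (hq t).hasDerivAt
  have hderiv := (Real.hasDerivAt_arccos
    (dot3_ne_neg_one (hp1 t) (hq1 t) (hne' t))
    (dot3_ne_one (hp1 t) (hq1 t) (hne t))).comp t (hdp.dot3 hdq)
  have hsub : ∀ a b c : Fin 3 → ℝ, dot3 (a - b) c = dot3 a c - dot3 b c := by
    intro a b c
    simp only [dot3, Pi.sub_apply]
    ring
  have hpp : dot3 (deriv p t) (p t) = 0 := by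
    rw [dot3_comm, dot3_deriv_eq_zero hdp hp1]
  rw [hsub, dot3_RgeoT_Yvec (hp1 t) (hq1 t) hpos (dot3_deriv_eq_zero hdq hq1),
    dot3_Yvec (hp1 t) (hq1 t), hpp]
  refine hderiv.deriv.trans ?_
  rw [one_div]
  ring
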